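/- Let H be a free module of finite rank over the polynomial ring ℂ[z], let K := ℂ((z^{−1})) be the field of formal Laurent series in t := z^{−1} (with ℂ[z]-algebra structure z ↦ t^{−1}), let Ĥ := K ⊗_{ℂ[z]} H, and let ι : H → Ĥ be the canonical (injective) map. Suppose L ⊆ Ĥ is a ℂ-linear subspace such that Ĥ = ι(H) ⊕ L as ℂ-vector spaces and t·L ⊆ L. Set B := ι(H) ∩ (z·L), where z·L := {z·l : l ∈ L} (z = t^{−1} is invertible in K). Then every element of ι(H) can be written uniquely as a finite sum Σ_{k≥0} z^k·b_k with b_k ∈ B; equivalently, the natural ℂ-linear map ⊕_{k∈ℕ} B → ι(H), (b_k) ↦ Σ z^k b_k, is bijective (ℋ^{(0)} = B[z]). -/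

import Mathlib

noncomputable section

/-- The element `t = z⁻¹` of the field `K = ℂ((z⁻¹))` of formal Laurent series in `t`. -/
def tL : LaurentSeries ℂ := HahnSeries.single 1 1

/-- The `ℂ[z]`-algebra structure on `K = ℂ((z⁻¹))` sending `z` to `t⁻¹`. -/
def lsAlgebra : Algebra (Polynomial ℂ) (LaurentSeries ℂ) :=
  (Polynomial.aeval (tL⁻¹ : LaurentSeries ℂ)).toRingHom.toAlgebra

attribute [local instance] lsAlgebra

instance : SMulCommClass (Polynomial ℂ) ℂ (LaurentSeries ℂ) :=
  ⟨fun p c x => by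
    have h : ∀ y : LaurentSeries ℂ, c • y = HahnSeries.single (0 : ℤ) c * y :=
      fun y => HahnSeries.single_zero_mul_eq_smul.symm
    rw [Algebra.smul_def, Algebra.smul_def, h, h, mul_left_comm]⟩

/-- The completion `Ĥ = K ⊗_{ℂ[z]} H` of a `ℂ[z]`-module `H`. -/
abbrev Hhat (H : Type) [AddCommGroup H] [Module (Polynomial ℂ) H] :=
  TensorProduct (Polynomial ℂ) (LaurentSeries ℂ) H

/-- The canonical map `ι : H → Ĥ = K ⊗_{ℂ[z]} H`, `h ↦ 1 ⊗ h`. -/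
def canMap (H : Type) [AddCommGroup H] [Module (Polynomial ℂ) H] :
    H →ₗ[Polynomial ℂ] Hhat H :=
  TensorProduct.mk (Polynomial ℂ) (LaurentSeries ℂ) H 1


open Polynomial in
theorem aux_stab {K V : Type} [Field K] [Algebra ℂ K] [AddCommGroup V] [Module K V]
    [Module ℂ V] [IsScalarTower ℂ K V] (t : K) (L : Submodule ℂ V)
    (hstab : ∀ x ∈ L, t • x ∈ L) (p : ℂ[X]) : ∀ x ∈ L, (aeval t p) • x ∈ L := by
  induction p using Polynomial.induction_on' with
  | add p q hp hq =>
    intro x hx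
    rw [map_add, add_smul]
    exact L.add_mem (hp x hx) (hq x hx)
  | monomial n a =>
    intro x hx
    rw [aeval_monomial, mul_smul, algebraMap_smul]
    apply L.smul_mem
    induction n with
    | zero => simpa using hx
    | succ n ih => rw [pow_succ', mul_smul]; exact hstab _ ih

open Polynomial in
theorem aux_torsion {K V : Type} [Field K] [Algebra ℂ K] [AddCommGroup V] [Module K V]
    [Module ℂ V] [IsScalarTower ℂ K V] (t : K)
    (ht : ∀ p : ℂ[X], p ≠ 0 → aeval t p ≠ 0) (L : Submodule ℂ V)
    (hstab : ∀ x ∈ L, t • x ∈ L) (S : Set V) (hS : S.Countable)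
    (hspan : ∀ x, ∃ h ∈ Submodule.span ℂ S, ∃ l ∈ L, x = h + l) (x : V) :
    ∃ p : ℂ[X], p ≠ 0 ∧ (aeval t p) • x ∈ L := by
  have htl : ∀ a : ℂ, t - algebraMap ℂ K a ≠ 0 := by
    intro a
    simpa using ht (X - C a) (X_sub_C_ne_zero a)
  have hnot : ¬ LinearIndependent ℂ
      (fun a : ℂ => L.mkQ ((t - algebraMap ℂ K a)⁻¹ • x)) := by
    intro hli
    have h1 := hli.cardinal_le_rank
    have h2 : Submodule.span ℂ (L.mkQ '' S) = ⊤ := by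
      rw [eq_top_iff]
      rintro q -
      obtain ⟨y, rfl⟩ := L.mkQ_surjective q
      obtain ⟨h, hh, l, hl, rfl⟩ := hspan y
      rw [map_add, (by simpa using hl : L.mkQ l = 0), add_zero, ← Submodule.map_span]
      exact ⟨h, hh, rfl⟩
    have h3 : Module.rank ℂ (V ⧸ L) ≤ Cardinal.aleph0 := by
      rw [← rank_top, ← h2]
      exact (rank_span_le _).trans (Cardinal.le_aleph0_iff_set_countable.2 (hS.image _))
    have h4 := h1.trans h3
    rw [Cardinal.mk_complex] at h4
    exact absurd Cardinal.aleph0_lt_continuum (not_lt.2 h4)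
  rw [not_linearIndependent_iff] at hnot
  obtain ⟨s, g, hsum, i, hi, hgi⟩ := hnot
  refine ⟨∑ i ∈ s, C (g i) * ∏ j ∈ s.erase i, (X - C j), ?_, ?_⟩
  · intro h0
    have := congrArg (eval i) h0
    rw [eval_finsetSum, Finset.sum_eq_single i] at this
    · simp only [eval_mul, eval_C, eval_prod, eval_sub, eval_X, eval_zero, mul_eq_zero, hgi,
        false_or, Finset.prod_eq_zero_iff] at this
      obtain ⟨j, hj, hj'⟩ := this
      exact (Finset.mem_erase.1 hj).1 (sub_eq_zero.1 hj').symm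
    · intro b hb hbi
      rw [eval_mul, eval_prod, Finset.prod_eq_zero (Finset.mem_erase.2 ⟨hbi.symm, hi⟩) (by simp),
        mul_zero]
    · exact fun h => absurd hi h
  · have hm : ∑ i ∈ s, g i • (t - algebraMap ℂ K i)⁻¹ • x ∈ L := by
      rw [← L.ker_mkQ, LinearMap.mem_ker, map_sum]
      simpa only [map_smul] using hsum
    have := aux_stab t L hstab (∏ j ∈ s, (X - C j)) _ hm
    convert this using 1
    rw [Finset.smul_sum, map_sum, Finset.sum_smul]
    refine Finset.sum_congr rfl fun i hi => ?_
    rw [← Finset.mul_prod_erase s _ hi, ← algebraMap_smul K (g i), ← mul_smul, ← mul_smul]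
    congr 1
    simp only [map_mul, aeval_C, map_sub, aeval_X]
    field_simp [htl i]

open Polynomial in
theorem aux_nilp {K V : Type} [Field K] [Algebra ℂ K] [AddCommGroup V] [Module K V]
    [Module ℂ V] [IsScalarTower ℂ K V] (t : K)
    (ht : ∀ p : ℂ[X], p ≠ 0 → aeval t p ≠ 0) (L H : Submodule ℂ V)
    (hstab : ∀ x ∈ L, t • x ∈ L) (S : Finset V)
    (hS : ∀ M : Submodule ℂ V, (∀ s ∈ S, s ∈ M) → (∀ x ∈ M, t⁻¹ • x ∈ M) → H ≤ M)
    (hspan : ∀ x, ∃ h ∈ H, ∃ l ∈ L, x = h + l) (x : V) :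
    ∃ k : ℕ, t ^ k • x ∈ L := by
  have ht0 : t ≠ 0 := by simpa using ht X X_ne_zero
  have hpow : ∀ (m : ℕ), ∀ x ∈ L, t ^ m • x ∈ L := fun m x hx => by
    simpa using aux_stab t L hstab (X ^ m) x hx
  have hcomm : ∀ (a : ℂ) (b : K) (v : V), b • a • v = a • b • v := fun a b v => by
    rw [← algebraMap_smul K a, ← algebraMap_smul K a, smul_comm]
  -- countable span
  have hH : H ≤ Submodule.span ℂ (⋃ n : ℕ, (fun v : V => t⁻¹ ^ n • v) '' (S : Set V)) := by
    apply hS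
    · intro s hs
      exact Submodule.subset_span (Set.mem_iUnion.2 ⟨0, s, hs, by simp⟩)
    · intro y hy
      induction hy using Submodule.span_induction with
      | mem y hy =>
        obtain ⟨n, s, hs, rfl⟩ := Set.mem_iUnion.1 hy
        exact Submodule.subset_span (Set.mem_iUnion.2 ⟨n+1, s, hs, by simp [pow_succ', mul_smul]⟩)
      | zero => simp
      | add a b _ _ ha hb => rw [smul_add]; exact Submodule.add_mem _ ha hb
      | smul a b _ hb => rw [hcomm]; exact Submodule.smul_mem _ _ hb
  have htor := aux_torsion t ht L hstab
    (⋃ n : ℕ, (fun v : V => t⁻¹ ^ n • v) '' (S : Set V))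
    (Set.countable_iUnion fun n => (S.countable_toSet.image _))
    (fun x => by
      obtain ⟨h, hh, l, hl, e⟩ := hspan x
      exact ⟨h, hH hh, l, hl, e⟩)
  classical
  choose P hP0 hP using htor
  let p : ℂ[X] := ∏ s ∈ S, P s
  have hp0 : p ≠ 0 := Finset.prod_ne_zero_iff.2 fun s _ => hP0 s
  let M : Submodule ℂ V :=
    { carrier := {y | ∃ k : ℕ, t ^ k • (aeval t p) • y ∈ L}
      zero_mem' := ⟨0, by simp⟩
      add_mem' := by
        rintro a b ⟨k, hk⟩ ⟨m, hm⟩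
        refine ⟨k + m, ?_⟩
        rw [smul_add, smul_add]
        refine L.add_mem ?_ ?_
        · rw [add_comm, pow_add, mul_smul]; exact hpow _ _ hk
        · rw [pow_add, mul_smul]; exact hpow _ _ hm
      smul_mem' := by
        rintro c y ⟨k, hk⟩
        refine ⟨k, ?_⟩
        rw [hcomm, hcomm]
        exact L.smul_mem _ hk }
  have hHM : H ≤ M := by
    apply hS
    · intro s hs
      refine ⟨0, ?_⟩
      have : p = (∏ s ∈ S.erase s, P s) * P s := (Finset.prod_erase_mul _ _ hs).symm
      rw [pow_zero, one_smul, this, map_mul, mul_smul]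
      exact aux_stab t L hstab _ _ (hP s)
    · rintro y ⟨k, hk⟩
      refine ⟨k + 1, ?_⟩
      have : t ^ (k+1) • (aeval t p) • t⁻¹ • y = t ^ k • (aeval t p) • y := by
        simp only [← mul_smul]
        congr 1
        field_simp
        try ring
      rw [this]; exact hk
  have hM : ∀ y, y ∈ M := by
    intro y
    obtain ⟨h, hh, l, hl, rfl⟩ := hspan y
    refine M.add_mem (hHM hh) ⟨0, ?_⟩
    rw [pow_zero, one_smul]
    exact aux_stab t L hstab _ _ hl
  obtain ⟨k, hk⟩ := hM ((aeval t p)⁻¹ • x)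
  rw [smul_inv_smul₀ (ht p hp0)] at hk
  exact ⟨k, hk⟩

theorem aux_main {K V : Type} [Field K] [Algebra ℂ K] [AddCommGroup V] [Module K V]
    [Module ℂ V] [IsScalarTower ℂ K V] (t : K) (ht0 : t ≠ 0) (L H : Submodule ℂ V)
    (hstab : ∀ x ∈ L, t • x ∈ L) (hz : ∀ x ∈ H, t⁻¹ • x ∈ H)
    (hdisj : ∀ x ∈ H, x ∈ L → x = 0)
    (hspan : ∀ x, ∃ h ∈ H, ∃ l ∈ L, x = h + l)
    (hn : ∀ x : V, ∃ k : ℕ, t ^ k • x ∈ L) (x : V) (hx : x ∈ H) :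
    ∃! c : ℕ →₀ V, (∀ k, c k ∈ H ∧ ∃ l ∈ L, c k = t⁻¹ • l) ∧
      x = c.sum fun k b => (t⁻¹ ^ k) • b := by
  have hpow : ∀ (m : ℕ), ∀ x ∈ L, t ^ m • x ∈ L := fun m x hx => by
    induction m with
    | zero => simpa using hx
    | succ n ih => rw [pow_succ', mul_smul]; exact hstab _ ih
  apply existsUnique_of_exists_of_unique
  · obtain ⟨k, hk⟩ := hn x
    induction k generalizing x with
    | zero =>
      refine ⟨0, fun k => ⟨H.zero_mem, 0, L.zero_mem, by simp⟩, ?_⟩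
      simpa using hdisj x hx (by simpa using hk)
    | succ k ih =>
      obtain ⟨h, hh, l, hl, e⟩ := hspan (t • x)
      have hhk : t ^ k • h ∈ L := by
        have : t ^ k • h = t ^ (k+1) • x - t ^ k • l := by
          rw [pow_succ, mul_smul, e, smul_add, add_sub_cancel_right]
        rw [this]
        exact L.sub_mem hk (hpow _ _ hl)
      obtain ⟨c, hc, hce⟩ := ih h hh hhk
      have hxe : x = t⁻¹ • l + t⁻¹ • h := by
        rw [← smul_add, add_comm, ← e, inv_smul_smul₀ ht0]
      have hlH : t⁻¹ • l ∈ H := by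
        rw [← sub_eq_iff_eq_add] at hxe
        rw [← hxe]
        exact H.sub_mem hx (hz _ hh)
      refine ⟨Finsupp.single 0 (t⁻¹ • l) + c.embDomain ⟨Nat.succ, Nat.succ_injective⟩, ?_, ?_⟩
      · intro j
        cases j with
        | zero =>
          have : c.embDomain ⟨Nat.succ, Nat.succ_injective⟩ 0 = 0 :=
            Finsupp.embDomain_of_notMem_range _ _ _ (by simp)
          rw [Finsupp.add_apply, this]
          simpa using ⟨hlH, l, hl, rfl⟩
        | succ j =>
          have : c.embDomain ⟨Nat.succ, Nat.succ_injective⟩ (j+1) = c j :=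
            Finsupp.embDomain_apply_self ⟨Nat.succ, Nat.succ_injective⟩ c j
          rw [Finsupp.add_apply, this]
          simpa using hc j
      · rw [Finsupp.sum_add_index' (by simp) (by simp), Finsupp.sum_single_index (by simp),
          Finsupp.sum_embDomain]
        conv_lhs => rw [hxe, hce]
        simp [Finsupp.sum, Finset.smul_sum, pow_succ', mul_smul]
  · rintro c d ⟨hc, hce⟩ ⟨hd, hde⟩
    by_contra hne
    have hsub : (c - d).sum (fun k b => (t⁻¹ ^ k) • b) = 0 := by
      rw [Finsupp.sum_sub_index (fun _ _ _ => smul_sub _ _ _), ← hce, ← hde, sub_self]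
    have hB : ∀ k, (c - d) k ∈ H ∧ t • (c - d) k ∈ L := by
      intro k
      obtain ⟨h1, l, hl, e⟩ := hc k
      obtain ⟨h2, l', hl', e'⟩ := hd k
      rw [Finsupp.sub_apply]
      refine ⟨H.sub_mem h1 h2, ?_⟩
      rw [e, e', ← smul_sub, smul_inv_smul₀ ht0]
      exact L.sub_mem hl hl'
    have hs : (c - d).support.Nonempty := Finsupp.support_nonempty_iff.2 (sub_ne_zero.2 hne)
    generalize c - d = f at *
    let n := f.support.max' hs
    have hnm : n ∈ f.support := f.support.max'_mem hs
    apply Finsupp.mem_support_iff.1 hnm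
    apply hdisj _ (hB n).1
    have h0 := congrArg (fun v => t ^ n • v) hsub
    simp only [Finsupp.sum, smul_zero] at h0
    rw [← Finset.add_sum_erase _ _ hnm, smul_add, ← mul_smul, ← mul_pow, mul_inv_cancel₀ ht0,
      one_pow, one_smul] at h0
    rw [eq_neg_of_add_eq_zero_left h0, Finset.smul_sum]
    refine L.neg_mem (L.sum_mem fun k hk => ?_)
    have hkn : k < n := lt_of_le_of_ne (f.support.le_max' _ (Finset.mem_of_mem_erase hk))
      (Finset.ne_of_mem_erase hk)
    obtain ⟨m, hm⟩ := Nat.exists_eq_add_of_lt hkn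
    have : t ^ n • t⁻¹ ^ k • f k = t ^ m • t • f k := by
      rw [← mul_smul, ← mul_smul, hm]
      congr 1
      rw [add_assoc, pow_add, pow_succ, inv_pow]
      field_simp
    rw [this]
    exact hpow _ _ (hB k).2

theorem aux_lsmap (c : ℂ) :
    (Polynomial.C c : Polynomial ℂ) • (1 : LaurentSeries ℂ) = c • (1 : LaurentSeries ℂ) := by
  rw [Algebra.smul_def, mul_one]
  change Polynomial.aeval (tL⁻¹ : LaurentSeries ℂ) (Polynomial.C c) = _
  rw [Polynomial.aeval_C, Algebra.algebraMap_eq_smul_one]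
  ext n
  rw [← Algebra.algebraMap_eq_smul_one, HahnSeries.algebraMap_apply']
  rw [PowerSeries.algebraMap_apply, Algebra.algebraMap_self_apply, HahnSeries.ofPowerSeries_C,
    HahnSeries.C_apply, ← HahnSeries.single_zero_mul_eq_smul, mul_one]

theorem aux_lsX (x : LaurentSeries ℂ) :
    (Polynomial.X : Polynomial ℂ) • x = tL⁻¹ * x := by
  rw [Algebra.smul_def]
  congr 1
  change Polynomial.aeval (tL⁻¹ : LaurentSeries ℂ) Polynomial.X = _
  rw [Polynomial.aeval_X]

theorem aux_coeff (p : Polynomial ℂ) (n : ℕ) :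
    (@Polynomial.aeval ℂ (LaurentSeries ℂ) _ _ HahnSeries.instAlgebra tL p).coeff (n : ℤ)
      = p.coeff n := by
  letI : Algebra ℂ (LaurentSeries ℂ) := HahnSeries.instAlgebra
  induction p using Polynomial.induction_on' with
  | add p q hp hq => rw [map_add, HahnSeries.coeff_add, hp, hq, Polynomial.coeff_add]
  | monomial m a =>
    rw [Polynomial.aeval_monomial, HahnSeries.algebraMap_apply, HahnSeries.C_apply, tL,
      HahnSeries.single_pow, HahnSeries.single_mul_single, Polynomial.coeff_monomial]
    simp [HahnSeries.coeff_single, eq_comm]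

/-- Let `H` be a free `ℂ[z]`-module of finite rank, `Ĥ = K ⊗_{ℂ[z]} H` with
`K = ℂ((z⁻¹))`, and let `L ⊆ Ĥ` be a `ℂ`-subspace with `Ĥ = ι(H) ⊕ L` (every element has
a unique decomposition) and `t·L ⊆ L` where `t = z⁻¹`. Set
`B = ι(H) ∩ z·L`. Then every element of `ι(H)` is uniquely a finite sum `Σ_k z^k·b_k` with
`b_k ∈ B`; i.e. `ℋ^{(0)} = B[z]`. -/
theorem opposite_subspace_good_basis_decomposition
    (H : Type) [AddCommGroup H] [Module (Polynomial ℂ) H]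
    [Module.Free (Polynomial ℂ) H] [Module.Finite (Polynomial ℂ) H]
    (L : Submodule ℂ (Hhat H))
    (hdecomp : ∀ x : Hhat H, ∃! pr : Hhat H × Hhat H,
      pr.1 ∈ Set.range (canMap H) ∧ pr.2 ∈ L ∧ x = pr.1 + pr.2)
    (hstab : ∀ x ∈ L, tL • x ∈ L) :
    ∀ x ∈ Set.range (canMap H),
      ∃! c : ℕ →₀ Hhat H,
        (∀ k, c k ∈ Set.range (canMap H) ∧ ∃ l ∈ L, c k = (tL⁻¹ : LaurentSeries ℂ) • l) ∧
        x = c.sum fun k b => ((tL⁻¹ : LaurentSeries ℂ) ^ k) • b := by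
  letI : Algebra ℂ (LaurentSeries ℂ) := HahnSeries.instAlgebra
  haveI : IsScalarTower ℂ (LaurentSeries ℂ) (Hhat H) := by
    refine ⟨fun c k v => ?_⟩
    induction v using TensorProduct.induction_on with
    | zero => simp
    | add a b ha hb => rw [smul_add, ha, hb, smul_add, smul_add]
    | tmul a h =>
      rw [TensorProduct.smul_tmul', TensorProduct.smul_tmul', TensorProduct.smul_tmul']
      congr 1
      rw [smul_eq_mul, smul_eq_mul, ← HahnSeries.single_zero_mul_eq_smul,
        ← HahnSeries.single_zero_mul_eq_smul, mul_assoc]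
  have ht : ∀ p : Polynomial ℂ, p ≠ 0 → Polynomial.aeval tL p ≠ 0 := by
    intro p hp h0
    apply hp
    ext n
    rw [← aux_coeff p n]
    exact congrArg (fun f : LaurentSeries ℂ => f.coeff (n : ℤ)) h0
  have ht0 : tL ≠ 0 := by simpa using ht Polynomial.X Polynomial.X_ne_zero
  have hC : ∀ (c : ℂ) (h : H), canMap H (Polynomial.C c • h) = c • canMap H h := by
    intro c h
    change (1 : LaurentSeries ℂ) ⊗ₜ[Polynomial ℂ] (Polynomial.C c • h) =
      c • ((1 : LaurentSeries ℂ) ⊗ₜ[Polynomial ℂ] h)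
    rw [← TensorProduct.smul_tmul, aux_lsmap, TensorProduct.smul_tmul']
  have hX : ∀ (h : H), canMap H ((Polynomial.X : Polynomial ℂ) • h) = tL⁻¹ • canMap H h := by
    intro h
    change (1 : LaurentSeries ℂ) ⊗ₜ[Polynomial ℂ] ((Polynomial.X : Polynomial ℂ) • h) =
      (tL⁻¹ : LaurentSeries ℂ) • ((1 : LaurentSeries ℂ) ⊗ₜ[Polynomial ℂ] h)
    rw [← TensorProduct.smul_tmul, aux_lsX, TensorProduct.smul_tmul', smul_eq_mul]
  let H0 : Submodule ℂ (Hhat H) :=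
    { carrier := Set.range (canMap H)
      zero_mem' := ⟨0, map_zero _⟩
      add_mem' := by
        rintro _ _ ⟨a, rfl⟩ ⟨b, rfl⟩
        exact ⟨a + b, map_add _ _ _⟩
      smul_mem' := by
        rintro c _ ⟨a, rfl⟩
        exact ⟨_, hC c a⟩ }
  have hspan : ∀ x : Hhat H, ∃ h ∈ H0, ∃ l ∈ L, x = h + l := by
    intro x
    obtain ⟨pr, ⟨h1, h2, h3⟩, -⟩ := hdecomp x
    exact ⟨pr.1, h1, pr.2, h2, h3⟩
  have hdisj : ∀ x ∈ H0, x ∈ L → x = 0 := by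
    intro x hx hL
    have := (hdecomp x).unique (y₁ := (x, 0)) (y₂ := (0, x))
      ⟨hx, L.zero_mem, (add_zero x).symm⟩ ⟨H0.zero_mem, hL, (zero_add x).symm⟩
    exact congrArg Prod.fst this
  obtain ⟨S, hS⟩ := (Module.Finite.fg_top : (⊤ : Submodule (Polynomial ℂ) H).FG)
  classical
  have hn := aux_nilp tL ht L H0 hstab (S.image (canMap H)) (by
    intro M hM hz
    rintro _ ⟨h, rfl⟩
    have hh : h ∈ Submodule.span (Polynomial ℂ) (S : Set H) := by rw [hS]; trivial
    induction hh using Submodule.span_induction with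
    | mem y hy => exact hM _ (Finset.mem_image_of_mem _ hy)
    | zero => rw [map_zero]; exact M.zero_mem
    | add a b _ _ ha hb => rw [map_add]; exact M.add_mem ha hb
    | smul p y _ hy =>
      induction p using Polynomial.induction_on with
      | C a => rw [hC]; exact M.smul_mem _ hy
      | add p q hp hq => rw [add_smul, map_add]; exact M.add_mem hp hq
      | monomial n a ih =>
        have : (Polynomial.C a * Polynomial.X ^ (n+1) : Polynomial ℂ) • y =
            (Polynomial.X : Polynomial ℂ) • (Polynomial.C a * Polynomial.X ^ n) • y := by
          rw [← mul_smul]; congr 1; ring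
        rw [this, hX]
        exact hz _ ih) hspan
  intro x hx
  exact aux_main tL ht0 L H0 hstab (by rintro _ ⟨h, rfl⟩; exact ⟨_, hX h⟩) hdisj hspan hn x hx
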